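/- Let n be a natural number and let k_0, …, k_n, a_1, …, a_n, q_1, …, q_n be integers. Then the congruence C(k_0 + ⋯ + k_n + a_1 + ⋯ + a_n, 2) + Σ_{j=1}^n (a_j + q_j - 1)(n - j + Σ_{l=j}^n k_l) + C(k_0,2) + Σ_{j=1}^n (C(a_j,2) + C(k_j,2)) + Σ_{0≤j<l≤n} k_j(k_l + a_l + q_l) + Σ_{j=1}^n a_j(Σ_{l=j}^n k_l + Σ_{l=j+1}^n (a_l + q_l)) ≡ Σ_{0≤j<l≤n} k_j·q_l + Σ_{1≤j<l≤n} a_j·q_l + Σ_{j=1}^n (a_j + q_j - 1)(n - j) + Σ_{1≤j≤l≤n} (a_j + q_j - 1)·k_l (mod 2) holds, where C(k,2) denotes k(k-1)/2. -/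

import Mathlib

open Finset

theorem c2_add (x y : ℤ) : (x + y) * (x + y - 1) / 2 = x * (x - 1) / 2 + y * (y - 1) / 2 + x * y := by
  have hx : 2 ∣ x * (x - 1) := (Int.even_mul_pred_self x).two_dvd
  have hy : 2 ∣ y * (y - 1) := (Int.even_mul_pred_self y).two_dvd
  obtain ⟨u, hu⟩ := hx
  obtain ⟨v, hv⟩ := hy
  have h : (x + y) * (x + y - 1) = 2 * (u + v + x * y) := by linear_combination hu + hv
  rw [h, hu, hv]
  simp

theorem tri_range (n : ℕ) (f : ℕ → ℕ → ℤ) :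
    (∑ j ∈ Finset.range (n + 1 + 1), ∑ l ∈ Finset.Icc (j + 1) (n + 1), f j l) =
      (∑ j ∈ Finset.range (n + 1), ∑ l ∈ Finset.Icc (j + 1) n, f j l)
        + ∑ j ∈ Finset.range (n + 1), f j (n + 1) := by
  rw [Finset.sum_range_succ, ← Finset.sum_add_distrib]
  simp only [Finset.Icc_eq_empty_of_lt (Nat.lt_succ_self (n + 1)), Finset.sum_empty, add_zero]
  refine Finset.sum_congr rfl fun j hj => ?_
  rw [Finset.mem_range] at hj
  exact Finset.sum_Icc_succ_top (by omega) _

theorem tri_lt (n : ℕ) (f : ℕ → ℕ → ℤ) :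
    (∑ j ∈ Finset.Icc 1 (n + 1), ∑ l ∈ Finset.Icc (j + 1) (n + 1), f j l) =
      (∑ j ∈ Finset.Icc 1 n, ∑ l ∈ Finset.Icc (j + 1) n, f j l)
        + ∑ j ∈ Finset.Icc 1 n, f j (n + 1) := by
  rw [Finset.sum_Icc_succ_top (by omega), ← Finset.sum_add_distrib]
  simp only [Finset.Icc_eq_empty_of_lt (Nat.lt_succ_self (n + 1)), Finset.sum_empty, add_zero]
  refine Finset.sum_congr rfl fun j hj => ?_
  rw [Finset.mem_Icc] at hj
  exact Finset.sum_Icc_succ_top (by omega) _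

theorem tri_le (n : ℕ) (f : ℕ → ℕ → ℤ) :
    (∑ j ∈ Finset.Icc 1 (n + 1), ∑ l ∈ Finset.Icc j (n + 1), f j l) =
      (∑ j ∈ Finset.Icc 1 n, ∑ l ∈ Finset.Icc j n, f j l)
        + (∑ j ∈ Finset.Icc 1 n, f j (n + 1)) + f (n + 1) (n + 1) := by
  rw [Finset.sum_Icc_succ_top (by omega), ← Finset.sum_add_distrib]
  simp only [Finset.Icc_self, Finset.sum_singleton]
  congr 1
  refine Finset.sum_congr rfl fun j hj => ?_
  rw [Finset.mem_Icc] at hj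
  exact Finset.sum_Icc_succ_top (by omega) _

theorem key (n : ℕ) (k a : ℕ → ℤ) :
    ((∑ j ∈ Finset.range (n + 1), k j) + ∑ j ∈ Finset.Icc 1 n, a j) *
          (((∑ j ∈ Finset.range (n + 1), k j) + ∑ j ∈ Finset.Icc 1 n, a j) - 1) / 2
      = k 0 * (k 0 - 1) / 2
      + (∑ j ∈ Finset.Icc 1 n, (a j * (a j - 1) / 2 + k j * (k j - 1) / 2))
      + (∑ j ∈ Finset.range (n + 1), ∑ l ∈ Finset.Icc (j + 1) n, k j * (k l + a l))
      + (∑ j ∈ Finset.Icc 1 n, ∑ l ∈ Finset.Icc j n, a j * k l)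
      + (∑ j ∈ Finset.Icc 1 n, ∑ l ∈ Finset.Icc (j + 1) n, a j * a l) := by
  induction n with
  | zero => simp
  | succ n ih =>
    rw [tri_range, tri_lt, tri_le, Finset.sum_range_succ _ (n + 1),
      Finset.sum_Icc_succ_top (by omega), Finset.sum_Icc_succ_top (by omega),
      add_add_add_comm, c2_add, c2_add (k (n + 1)), ih]
    simp only [← Finset.sum_mul]
    ring

/-- The computation of the sign `(-1)^η` of the brace operation
`b_n(f; g_1, …, g_n)` on the endomorphism operad of a graded module:
`C(k_0 + ⋯ + k_n + a_1 + ⋯ + a_n, 2) + Σ_{j=1}^n (a_j + q_j - 1)(n - j + Σ_{l=j}^n k_l)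
 + C(k_0,2) + Σ_{j=1}^n (C(a_j,2) + C(k_j,2)) + Σ_{0≤j<l≤n} k_j(k_l + a_l + q_l)
 + Σ_{j=1}^n a_j(Σ_{l=j}^n k_l + Σ_{l=j+1}^n (a_l + q_l))
 ≡ Σ_{0≤j<l≤n} k_j q_l + Σ_{1≤j<l≤n} a_j q_l + Σ_{j=1}^n (a_j + q_j - 1)(n - j)
 + Σ_{1≤j≤l≤n} (a_j + q_j - 1) k_l (mod 2)`, where `C(k,2) = k(k-1)/2`. -/
theorem stmt4 (n : ℕ) (k a q : ℕ → ℤ) :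
    ((∑ j ∈ Finset.range (n + 1), k j) + ∑ j ∈ Finset.Icc 1 n, a j) *
          (((∑ j ∈ Finset.range (n + 1), k j) + ∑ j ∈ Finset.Icc 1 n, a j) - 1) / 2
      + (∑ j ∈ Finset.Icc 1 n, (a j + q j - 1) * ((n : ℤ) - j + ∑ l ∈ Finset.Icc j n, k l))
      + k 0 * (k 0 - 1) / 2
      + (∑ j ∈ Finset.Icc 1 n, (a j * (a j - 1) / 2 + k j * (k j - 1) / 2))
      + (∑ j ∈ Finset.range (n + 1), ∑ l ∈ Finset.Icc (j + 1) n, k j * (k l + a l + q l))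
      + (∑ j ∈ Finset.Icc 1 n,
          a j * ((∑ l ∈ Finset.Icc j n, k l) + ∑ l ∈ Finset.Icc (j + 1) n, (a l + q l))) ≡
    (∑ j ∈ Finset.range (n + 1), ∑ l ∈ Finset.Icc (j + 1) n, k j * q l)
      + (∑ j ∈ Finset.Icc 1 n, ∑ l ∈ Finset.Icc (j + 1) n, a j * q l)
      + (∑ j ∈ Finset.Icc 1 n, (a j + q j - 1) * ((n : ℤ) - j))
      + (∑ j ∈ Finset.Icc 1 n, ∑ l ∈ Finset.Icc j n, (a j + q j - 1) * k l) [ZMOD 2] := by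
  rw [key]
  simp only [mul_add, Finset.mul_sum, Finset.sum_add_distrib]
  rw [Int.modEq_iff_dvd]
  refine ⟨-(k 0 * (k 0 - 1) / 2
      + (∑ j ∈ Finset.Icc 1 n, a j * (a j - 1) / 2) + (∑ j ∈ Finset.Icc 1 n, k j * (k j - 1) / 2)
      + (∑ j ∈ Finset.range (n + 1), ∑ l ∈ Finset.Icc (j + 1) n, k j * k l)
      + (∑ j ∈ Finset.range (n + 1), ∑ l ∈ Finset.Icc (j + 1) n, k j * a l)
      + (∑ j ∈ Finset.Icc 1 n, ∑ l ∈ Finset.Icc j n, a j * k l)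
      + (∑ j ∈ Finset.Icc 1 n, ∑ l ∈ Finset.Icc (j + 1) n, a j * a l)), ?_⟩
  ring
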